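/- Let φ, m ∈ C_0^∞(ℝ^{2d}) with φ real-valued, and assume that for some multi-index α on ℝ^{2d} with |α| ≥ 2 there is a constant c > 0 such that |∂^α φ(η,ξ)| ≥ c at every point of supp m. Then there exists a constant C such that for all λ ≠ 0 and all Schwartz functions f, g on ℝ^d, ‖B_λ(f,g)‖_{L^∞} ≤ C |λ|^{−1/(2|α|)} ‖f‖_{L^1} ‖g‖_{L^1}. -/

import Mathlib

open MeasureTheory Filter Complex SchwartzMap
open scoped RealInnerProductSpace ENNReal

noncomputable section

/-- Euclidean space `ℝ^d`. -/
abbrev E (d : ℕ) : Type := EuclideanSpace ℝ (Fin d)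

/-- The Fourier transform `(2π)^{-d/2} ∫ e^{-i x·ξ} f(x) dx`. -/
def FT {d : ℕ} (f : E d → ℂ) (ξ : E d) : ℂ :=
  (((2 * Real.pi) ^ (-(d : ℝ) / 2) : ℝ) : ℂ) *
    ∫ x : E d, Complex.exp (-(Complex.I * ((⟪x, ξ⟫ : ℝ) : ℂ))) * f x

/-- The bilinear oscillatory integral `B_λ(f,g)` with symbol `m` and phase `φ`. -/
def Bop {d : ℕ} (m : E d × E d → ℂ) (φ : E d × E d → ℝ) (lam : ℝ)
    (f g : 𝓢(E d, ℂ)) (x : E d) : ℂ :=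
  (((2 * Real.pi) ^ (-(d : ℝ) / 2) : ℝ) : ℂ) *
    ∫ p : E d × E d,
      Complex.exp (Complex.I * ((⟪x, p.1 + p.2⟫ + lam * φ p : ℝ) : ℂ)) *
        m p * FT (⇑f) p.1 * FT (⇑g) p.2

/-- Standard basis vector of `ℝ^d`. -/
def ev {d : ℕ} (i : Fin d) : E d := EuclideanSpace.single i 1

/-- The direction corresponding to `∂_{η_i}`. -/
def etaV {d : ℕ} (i : Fin d) : E d × E d := (ev i, 0)

/-- The direction corresponding to `∂_{ξ_i}`. -/
def xiV {d : ℕ} (i : Fin d) : E d × E d := (0, ev i)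

/-- Iterated (second) directional derivative: first in direction `u`, then in direction `v`. -/
def D2 {V : Type*} [NormedAddCommGroup V] [NormedSpace ℝ V]
    (φ : V → ℝ) (x u v : V) : ℝ :=
  fderiv ℝ (fun y => fderiv ℝ φ y u) x v

/-- The full `2d × 2d` Hessian matrix of `φ` at `x` in the variables `(η,ξ)`. -/
def hessMat {d : ℕ} (φ : E d × E d → ℝ) (x : E d × E d) :
    Matrix (Fin d ⊕ Fin d) (Fin d ⊕ Fin d) ℝ :=
  Matrix.of fun i j => D2 φ x (Sum.elim etaV xiV j) (Sum.elim etaV xiV i)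

/-- The `d × d` matrix `(A_i B_j φ)_{i,j}` for families of first-order directions `A`, `B`. -/
def derMat {d : ℕ} (φ : E d × E d → ℝ) (x : E d × E d)
    (A B : Fin d → E d × E d) : Matrix (Fin d) (Fin d) ℝ :=
  Matrix.of fun i j => D2 φ x (B j) (A i)


lemma sub_one (f f' : ℝ → ℝ) (hf : ∀ t, HasDerivAt f (f' t) t) (I : Set ℝ) (hI : I.OrdConnected)
    (c ε : ℝ) (hc : 0 < c) (h : ∀ t ∈ I, c ≤ f' t) :
    volume (I ∩ {t | |f t| ≤ ε}) ≤ ENNReal.ofReal (2 * (ε / c)) := by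
  have key := hI.convex.mul_sub_le_image_sub_of_le_deriv (f := f) (C := c)
    (fun t _ => (hf t).continuousAt.continuousWithinAt)
    (fun t _ => (hf t).differentiableAt.differentiableWithinAt)
    (fun t ht => by rw [(hf t).deriv]; exact h t (interior_subset ht))
  refine (Real.volume_le_diam _).trans (Metric.ediam_le ?_)
  have aux : ∀ x ∈ I ∩ {t | |f t| ≤ ε}, ∀ y ∈ I ∩ {t | |f t| ≤ ε}, x ≤ y →
      y - x ≤ 2 * (ε / c) := by
    intro x hx y hy hxy
    have h1 := key x hx.1 y hy.1 hxy
    have h2 := abs_le.1 (show |f x| ≤ ε from hx.2)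
    have h3 := abs_le.1 (show |f y| ≤ ε from hy.2)
    rw [← mul_div_assoc, le_div_iff₀ hc]
    linarith
  intro x hx y hy
  rw [edist_dist]
  apply ENNReal.ofReal_le_ofReal
  rw [Real.dist_eq]
  rcases le_total x y with hxy | hxy
  · rw [abs_sub_comm, abs_of_nonneg (by linarith)]; exact aux x hx y hy hxy
  · rw [abs_of_nonneg (by linarith)]; exact aux y hy x hx hxy

lemma mono_of (f f' : ℝ → ℝ) (hf : ∀ t, HasDerivAt f (f' t) t) (I : Set ℝ) (hI : I.OrdConnected)
    (c : ℝ) (hc : 0 < c) (h : ∀ t ∈ I, c ≤ f' t) : MonotoneOn f I := by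
  have key := hI.convex.mul_sub_le_image_sub_of_le_deriv (f := f) (C := c)
    (fun t _ => (hf t).continuousAt.continuousWithinAt)
    (fun t _ => (hf t).differentiableAt.differentiableWithinAt)
    (fun t ht => by rw [(hf t).deriv]; exact h t (interior_subset ht))
  intro x hx y hy hxy
  have := key x hx y hy hxy
  have : 0 ≤ c * (y - x) := mul_nonneg hc.le (by linarith)
  linarith

lemma sublevel (k : ℕ) : ∃ C : ℝ, 0 ≤ C ∧ ∀ (F : ℕ → ℝ → ℝ)
    (_ : ∀ j t, HasDerivAt (F j) (F (j+1) t) t) (I : Set ℝ) (_ : I.OrdConnected) (c ε : ℝ)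
    (_ : 0 < c) (_ : 0 < ε) (_ : ∀ t ∈ I, c ≤ F (k+1) t),
    volume (I ∩ {t | |F 0 t| ≤ ε}) ≤ ENNReal.ofReal (C * (ε / c) ^ (((k+1 : ℕ) : ℝ)⁻¹)) := by
  induction k with
  | zero =>
    refine ⟨2, by norm_num, ?_⟩
    intro F hF I hI c ε hc hε h
    simpa using sub_one (F 0) (F 1) (hF 0) I hI c ε hc h
  | succ k ih =>
    obtain ⟨C, hC, ih⟩ := ih
    refine ⟨2 + 2 * C, by positivity, ?_⟩
    intro F hF I hI c ε hc hε h
    set r := (ε / c) ^ (((k+1+1 : ℕ) : ℝ)⁻¹) with hr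
    have hr0 : 0 < r := by positivity
    have hrp : r ^ (k+2) = ε / c := by
      rw [hr]; exact Real.rpow_inv_natCast_pow (by positivity) (by omega)
    have hδ : 0 < c * r := by positivity
    have hmono := mono_of (F (k+1)) (F (k+2)) (hF (k+1)) I hI c hc h
    have hq : (ε / (c * r)) ^ (((k+1 : ℕ) : ℝ)⁻¹) = r := by
      have : ε / (c * r) = r ^ (k+1) := by
        rw [← div_div, ← hrp]; field_simp; ring
      rw [this]; exact Real.pow_rpow_inv_natCast hr0.le (by omega)
    have h1 := sub_one (F (k+1)) (F (k+2)) (hF (k+1)) I hI c (c * r) hc h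
    have h2 := ih F hF {t | t ∈ I ∧ c * r ≤ F (k+1) t} (by
      constructor
      intro x hx y hy z hz
      have hzI := hI.out hx.1 hy.1 hz
      exact ⟨hzI, hx.2.trans (hmono hx.1 hzI hz.1)⟩) (c * r) ε hδ hε (fun t ht => ht.2)
    have h3 := ih (fun j t => - F j t) (fun j t => (hF j t).neg)
      {t | t ∈ I ∧ F (k+1) t ≤ - (c * r)} (by
      constructor
      intro x hx y hy z hz
      have hzI := hI.out hx.1 hy.1 hz
      exact ⟨hzI, (hmono hzI hy.1 hz.2).trans hy.2⟩) (c * r) ε hδ hε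
      (fun t ht => by have := ht.2; linarith)
    rw [hq] at h2 h3
    have e1 : c * r / c = r := by field_simp
    rw [e1] at h1
    simp only [abs_neg] at h3
    have hsub : I ∩ {t | |F 0 t| ≤ ε} ⊆ (I ∩ {t | |F (k+1) t| ≤ c * r}) ∪
        (({t | t ∈ I ∧ c * r ≤ F (k+1) t} ∩ {t | |F 0 t| ≤ ε}) ∪
        ({t | t ∈ I ∧ F (k+1) t ≤ - (c * r)} ∩ {t | |F 0 t| ≤ ε})) := by
      rintro t ⟨htI, ht⟩
      by_cases ha : |F (k+1) t| ≤ c * r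
      · exact Or.inl ⟨htI, ha⟩
      · rcases lt_abs.1 (not_le.1 ha) with hb | hb
        · exact Or.inr (Or.inl ⟨⟨htI, hb.le⟩, ht⟩)
        · exact Or.inr (Or.inr ⟨⟨htI, by linarith⟩, ht⟩)
    refine (measure_mono hsub).trans ((measure_union_le _ _).trans
      ((add_le_add h1 ((measure_union_le _ _).trans (add_le_add h2 h3))).trans ?_))
    rw [← ENNReal.ofReal_add (by positivity) (by positivity),
      ← ENNReal.ofReal_add (by positivity) (by positivity)]
    apply ENNReal.ofReal_le_ofReal
    linarith

section sym
variable {W : Type*} [NormedAddCommGroup W] [NormedSpace ℝ W]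

lemma ifd_adj {φ : W → ℝ} (hφ : ContDiff ℝ (⊤ : ℕ∞) φ) (n : ℕ) : ∀ (i : Fin n) (x : W) (m : Fin (n+1) → W),
    iteratedFDeriv ℝ (n+1) φ x (m ∘ Equiv.swap i.castSucc i.succ) = iteratedFDeriv ℝ (n+1) φ x m := by
  have hd : ∀ j : ℕ, ContDiff ℝ (⊤ : ℕ∞) (iteratedFDeriv ℝ j φ) := fun j =>
    hφ.iteratedFDeriv_right (m := (⊤ : ℕ∞)) (i := j) (by exact_mod_cast le_top)
  have hdd : ∀ (j : ℕ) (w : Fin j → W) (u x : W), fderiv ℝ (fun y => iteratedFDeriv ℝ j φ y w) x u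
      = fderiv ℝ (iteratedFDeriv ℝ j φ) x u w := by
    intro j w u x
    have h1 : HasFDerivAt (iteratedFDeriv ℝ j φ) (fderiv ℝ (iteratedFDeriv ℝ j φ) x) x :=
      ((hd j).differentiable (by simp) x).hasFDerivAt
    have h2 := (ContinuousMultilinearMap.apply ℝ (fun _ : Fin j => W) ℝ w).hasFDerivAt.comp x h1
    have h3 : HasFDerivAt (fun y => iteratedFDeriv ℝ j φ y w) _ x := h2
    rw [h3.fderiv]; rfl
  induction n with
  | zero => intro i; exact i.elim0
  | succ n ih =>
    intro i x m
    refine Fin.cases ?_ (fun j => ?_) i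
    · have hs : IsSymmSndFDerivAt ℝ (iteratedFDeriv ℝ n φ) x :=
        (hd n).contDiffAt.isSymmSndFDerivAt (by simpa using WithTop.coe_le_coe.2 (le_top : (2:ℕ∞) ≤ ⊤))
      have hcalc : ∀ m : Fin (n+2) → W, iteratedFDeriv ℝ (n+1+1) φ x m =
          fderiv ℝ (fderiv ℝ (iteratedFDeriv ℝ n φ)) x (m 0) (m 1) (fun i => m i.succ.succ) := by
        intro m
        rw [iteratedFDeriv_succ_apply_left, ← hdd]
        have e : (fun y => iteratedFDeriv ℝ (n+1) φ y (Fin.tail m)) = fun y =>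
          (fderiv ℝ (iteratedFDeriv ℝ n φ) y (m 1)) (fun i => m i.succ.succ) := by
          funext y; rw [iteratedFDeriv_succ_apply_left]; rfl
        rw [e]
        have h0 : HasFDerivAt (fderiv ℝ (iteratedFDeriv ℝ n φ))
            (fderiv ℝ (fderiv ℝ (iteratedFDeriv ℝ n φ)) x) x :=
          (((hd n).fderiv_right (m := (⊤ : ℕ∞)) (by simp)).differentiable (by simp) x).hasFDerivAt
        have h1 : HasFDerivAt (fun y => fderiv ℝ (iteratedFDeriv ℝ n φ) y (m 1)) _ x :=
          h0.clm_apply (hasFDerivAt_const (m 1) x)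
        have h2 := (ContinuousMultilinearMap.apply ℝ (fun _ : Fin n => W) ℝ
          (fun i => m i.succ.succ)).hasFDerivAt.comp x h1
        have h3 : HasFDerivAt (fun y => (fderiv ℝ (iteratedFDeriv ℝ n φ) y (m 1))
          (fun i => m i.succ.succ)) _ x := h2
        rw [h3.fderiv]; simp
      rw [hcalc, hcalc]
      have a0 : (m ∘ Equiv.swap (Fin.castSucc (0 : Fin (n+1))) (Fin.succ 0)) 0 = m 1 := by
        simp
      have a1 : (m ∘ Equiv.swap (Fin.castSucc (0 : Fin (n+1))) (Fin.succ 0)) 1 = m 0 := by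
        simp
      have a2 : (fun i : Fin n => (m ∘ Equiv.swap (Fin.castSucc (0 : Fin (n+1))) (Fin.succ 0)) i.succ.succ)
          = fun i => m i.succ.succ := by
        funext i
        simp only [Function.comp]
        rw [Equiv.swap_apply_of_ne_of_ne]
        · simp [Fin.ext_iff]
        · simp [Fin.ext_iff]
      rw [a0, a1, a2, hs.eq]
    · rw [iteratedFDeriv_succ_apply_left, iteratedFDeriv_succ_apply_left, ← hdd, ← hdd]
      have e0 : (m ∘ Equiv.swap (Fin.castSucc j.succ) (Fin.succ j.succ)) 0 = m 0 := by
        simp only [Function.comp]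
        rw [Equiv.swap_apply_of_ne_of_ne] <;> simp [Fin.ext_iff]
      have e1 : Fin.tail (m ∘ Equiv.swap (Fin.castSucc j.succ) (Fin.succ j.succ)) =
          Fin.tail m ∘ Equiv.swap j.castSucc j.succ := by
        funext l
        simp only [Fin.tail, Function.comp]
        congr 1
        simp only [Equiv.swap_apply_def, Fin.ext_iff]
        split_ifs <;> simp_all
      rw [e0, e1]
      congr 2
      funext y
      exact ih j y _

lemma ifd_perm {φ : W → ℝ} (hφ : ContDiff ℝ (⊤ : ℕ∞) φ) (n : ℕ) (σ : Equiv.Perm (Fin (n+1))) (x : W) :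
    ∀ (m : Fin (n+1) → W),
    iteratedFDeriv ℝ (n+1) φ x (m ∘ σ) = iteratedFDeriv ℝ (n+1) φ x m := by
  have : σ ∈ Submonoid.closure (Set.range fun i : Fin n => Equiv.swap i.castSucc i.succ) := by
    rw [Equiv.Perm.mclosure_swap_castSucc_succ]; trivial
  induction this using Submonoid.closure_induction with
  | mem s hs => obtain ⟨i, rfl⟩ := hs; exact ifd_adj hφ n i x
  | one => intro m; rfl
  | mul s t _ _ hs ht =>
    intro m
    rw [Equiv.Perm.coe_mul, ← Function.comp_assoc, ht, hs]

lemma exists_diag {φ : W → ℝ} (hφ : ContDiff ℝ (⊤ : ℕ∞) φ) (n : ℕ) (x : W) (m : Fin (n+1) → W)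
    (h : iteratedFDeriv ℝ (n+1) φ x m ≠ 0) : ∃ v : W, iteratedFDeriv ℝ (n+1) φ x (fun _ => v) ≠ 0 := by
  by_contra! hv
  have h1 := (iteratedFDeriv ℝ (n+1) φ x).iteratedFDeriv_comp_diagonal x m
  simp only [hv] at h1
  have h2 : ∀ σ : Equiv.Perm (Fin (n+1)), iteratedFDeriv ℝ (n+1) φ x (fun i => m (σ i)) =
    iteratedFDeriv ℝ (n+1) φ x m := fun σ => ifd_perm hφ n σ x m
  simp only [h2] at h1
  have h3 : (iteratedFDeriv ℝ (n+1) (fun _ : W => (0:ℝ)) x) m = 0 := by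
    rw [iteratedFDeriv_fun_zero]; rfl
  rw [h3] at h1
  rw [Finset.sum_const, eq_comm, smul_eq_zero] at h1
  rcases h1 with h1 | h1
  · simp [Finset.card_univ, Fintype.card_perm, Nat.factorial_ne_zero] at h1
  · exact h h1
end sym

section multi
variable {W : Type*} [NormedAddCommGroup W] [NormedSpace ℝ W] [FiniteDimensional ℝ W]
  [MeasurableSpace W] [BorelSpace W]

lemma line_deriv {φ : W → ℝ} (hφ : ContDiff ℝ (⊤ : ℕ∞) φ) (p v : W) (j : ℕ) (t : ℝ) :
    HasDerivAt (fun t : ℝ => iteratedFDeriv ℝ j φ (p + t • v) (fun _ => v))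
      (iteratedFDeriv ℝ (j+1) φ (p + t • v) (fun _ => v)) t := by
  have hd : ContDiff ℝ (⊤ : ℕ∞) (iteratedFDeriv ℝ j φ) :=
    hφ.iteratedFDeriv_right (m := (⊤ : ℕ∞)) (i := j) (by exact_mod_cast le_top)
  have h1 : HasFDerivAt (iteratedFDeriv ℝ j φ) (fderiv ℝ (iteratedFDeriv ℝ j φ) (p + t • v))
      (p + t • v) := (hd.differentiable (by simp) _).hasFDerivAt
  have h2 := (ContinuousMultilinearMap.apply ℝ (fun _ : Fin j => W) ℝ (fun _ => v)).hasFDerivAt.comp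
    (p + t • v) h1
  have h3 : HasDerivAt (fun t : ℝ => p + t • v) v t := by
    simpa using ((hasDerivAt_id t).smul_const v).const_add p
  have h4 := h2.comp_hasDerivAt t h3
  rw [iteratedFDeriv_succ_apply_left]
  exact h4

lemma ifd_one (φ : W → ℝ) (x v : W) :
    iteratedFDeriv ℝ 1 φ x (fun _ => v) = fderiv ℝ φ x v := by
  rw [iteratedFDeriv_one_apply]

lemma multi_sublevel (μ : Measure W) [μ.IsAddHaarMeasure] {φ : W → ℝ}
    (hφ : ContDiff ℝ (⊤ : ℕ∞) φ) (k : ℕ) (v x₀ : W) (r c s : ℝ) (hc : 0 < c) (hs : |s| = 1)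
    (h : ∀ q ∈ Metric.ball x₀ r, c ≤ s * iteratedFDeriv ℝ (k+2) φ q (fun _ => v)) :
    ∃ C : ℝ, 0 ≤ C ∧ ∀ κ ε : ℝ, 0 < ε →
      μ (Metric.ball x₀ r ∩ {q | |κ + fderiv ℝ φ q v| ≤ ε}) ≤
        ENNReal.ofReal (C * ε ^ (((k+1 : ℕ) : ℝ)⁻¹)) := by
  obtain ⟨C, hC, hsub⟩ := sublevel k
  set B' := Metric.ball x₀ (r + ‖v‖) with hB'
  have hfin : μ B' ≠ ∞ := Metric.isBounded_ball.measure_lt_top.ne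
  have hcd : Continuous (fun q => fderiv ℝ φ q v) :=
    ((hφ.fderiv_right (m := (⊤ : ℕ∞)) (by simp)).continuous).clm_apply continuous_const
  refine ⟨C * (c⁻¹) ^ (((k+1 : ℕ) : ℝ)⁻¹) * (μ B').toReal, by positivity, ?_⟩
  intro κ ε hε
  set S := Metric.ball x₀ r ∩ {q | |κ + fderiv ℝ φ q v| ≤ ε} with hS
  have hSm : MeasurableSet S :=
    measurableSet_ball.inter (measurableSet_le (by fun_prop) measurable_const)
  set A := C * (ε / c) ^ (((k+1 : ℕ) : ℝ)⁻¹) with hA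
  have hA0 : 0 ≤ A := by positivity
  -- one-dimensional slices
  have slice : ∀ p : W, ∫⁻ t in Set.Icc (0:ℝ) 1, S.indicator 1 (p + t • v) ≤
      B'.indicator (fun _ => ENNReal.ofReal A) p := by
    intro p
    have hm : MeasurableSet ((fun t : ℝ => p + t • v) ⁻¹' S) :=
      hSm.preimage (by fun_prop : Continuous (fun t : ℝ => p + t • v)).measurable
    have e : (fun t : ℝ => S.indicator (1 : W → ℝ≥0∞) (p + t • v)) =
        ((fun t : ℝ => p + t • v) ⁻¹' S).indicator 1 := by
      funext t; rfl
    rw [e, lintegral_indicator_one hm, Measure.restrict_apply hm]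
    by_cases hp : p ∈ B'
    · rw [Set.indicator_of_mem hp]
      have := hsub (fun j t => s * (iteratedFDeriv ℝ (j+1) φ (p + t • v) (fun _ => v)
          + if j = 0 then κ else 0))
        (fun j t => by
          have := ((line_deriv hφ p v (j+1) t).add_const (if j = 0 then κ else 0)).const_mul s
          simpa using this)
        (Set.Icc 0 1 ∩ (fun t : ℝ => p + t • v) ⁻¹' (Metric.ball x₀ r)) (by
          apply Set.OrdConnected.inter Set.ordConnected_Icc
          have hl : (fun t : ℝ => p + t • v) = AffineMap.lineMap p (p + v) := by
            funext t; simp [AffineMap.lineMap_apply, add_comm]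
          rw [hl]
          exact ((convex_ball x₀ r).affine_preimage _).ordConnected)
        c ε hc hε (fun t ht => by simpa using h _ ht.2)
      refine (measure_mono ?_).trans this
      rintro t ⟨ht1, ht2⟩
      refine ⟨⟨ht2, ht1.1⟩, ?_⟩
      have h3 := ht1.2
      simp only [Set.mem_ofPred_eq, abs_mul, hs, one_mul, if_true] at h3 ⊢
      rw [ifd_one, add_comm]; exact h3
    · rw [Set.indicator_of_notMem hp, nonpos_iff_eq_zero]
      have : (fun t : ℝ => p + t • v) ⁻¹' S ∩ Set.Icc 0 1 = ∅ := by
        ext t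
        simp only [Set.mem_inter_iff, Set.mem_preimage, Set.mem_empty_iff_false, iff_false]
        rintro ⟨ht, ht0, ht1⟩
        apply hp
        have h1 : dist (p + t • v) x₀ < r := ht.1
        have h2 : dist p (p + t • v) ≤ ‖v‖ := by
          rw [dist_self_add_right, norm_smul, Real.norm_of_nonneg ht0]
          exact mul_le_of_le_one_left (norm_nonneg v) ht1
        have h3 := dist_triangle p (p + t • v) x₀
        simp only [hB', Metric.mem_ball]; linarith
      rw [this]; simp
  calc μ S = ∫⁻ t in Set.Icc (0:ℝ) 1, μ S := by simp
    _ = ∫⁻ t in Set.Icc (0:ℝ) 1, ∫⁻ p, S.indicator 1 (p + t • v) ∂μ := by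
        congr 1; funext t
        rw [← measure_preimage_add_right μ (t • v) S]
        have hm : MeasurableSet ((fun p : W => p + t • v) ⁻¹' S) :=
          hSm.preimage (by fun_prop : Continuous (fun p : W => p + t • v)).measurable
        rw [← lintegral_indicator_one hm]
        congr 1
    _ = ∫⁻ p, (∫⁻ t in Set.Icc (0:ℝ) 1, S.indicator 1 (p + t • v)) ∂μ := by
        apply lintegral_lintegral_swap
        apply Measurable.aemeasurable
        exact (measurable_one.indicator hSm).comp
          (by fun_prop : Continuous (fun z : ℝ × W => z.2 + z.1 • v)).measurable
    _ ≤ ∫⁻ p, B'.indicator (fun _ => ENNReal.ofReal A) p ∂μ := lintegral_mono slice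
    _ = ENNReal.ofReal A * μ B' := by
        rw [lintegral_indicator measurableSet_ball]; simp [hB']
    _ = _ := by
        rw [← ENNReal.ofReal_toReal hfin, ← ENNReal.ofReal_mul hA0]
        congr 1
        rw [hA, div_eq_mul_inv, Real.mul_rpow hε.le (by positivity), ENNReal.toReal_ofReal (by positivity)]
        ring

lemma osc (μ : Measure W) [μ.IsAddHaarMeasure] {φ : W → ℝ}
    (hφ : ContDiff ℝ (⊤ : ℕ∞) φ) (k : ℕ) (v x₀ : W) (r c s : ℝ) (hc : 0 < c) (hs : |s| = 1)
    (h : ∀ q ∈ Metric.ball x₀ r, c ≤ s * iteratedFDeriv ℝ (k+2) φ q (fun _ => v))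
    {ψ : W → ℂ} (hψ : ContDiff ℝ (⊤ : ℕ∞) ψ) (hψc : HasCompactSupport ψ)
    (hψs : tsupport ψ ⊆ Metric.ball x₀ r) :
    ∃ C : ℝ, ∀ (τ lam : ℝ) (L : W →L[ℝ] ℝ), 0 < τ → τ ≤ 1 → lam ≠ 0 → |lam|⁻¹ = τ ^ (2 * k + 4) →
      ‖∫ p, Complex.exp (Complex.I * ((L p + lam * φ p : ℝ) : ℂ)) * ψ p ∂μ‖ ≤ C * τ := by
  obtain ⟨C₀, hC₀, hsub⟩ := multi_sublevel μ hφ k v x₀ r c s hc hs h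
  -- derivative in direction v
  set D : W → ℝ := fun q => fderiv ℝ φ q v with hD
  have hDs : ContDiff ℝ (⊤ : ℕ∞) D :=
    (hφ.fderiv_right (m := (⊤ : ℕ∞)) (by simp)).clm_apply contDiff_const
  have hDc : Continuous (fun p => fderiv ℝ D p v) :=
    ((hDs.fderiv_right (m := (⊤ : ℕ∞)) (by simp)).continuous).clm_apply continuous_const
  have hψ'c : Continuous (fun p => fderiv ℝ ψ p v) :=
    ((hψ.fderiv_right (m := (⊤ : ℕ∞)) (by simp)).continuous).clm_apply continuous_const
  obtain ⟨M0, hM0⟩ := hψc.exists_bound_of_continuous hψ.continuous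
  obtain ⟨M1, hM1⟩ := (hψc.fderiv_apply (𝕜 := ℝ) v).exists_bound_of_continuous hψ'c
  have hcs2 : HasCompactSupport (fun p => ψ p * ((fderiv ℝ D p v : ℝ) : ℂ)) := hψc.mul_right
  obtain ⟨M2, hM2⟩ := hcs2.exists_bound_of_continuous
    (hψ.continuous.mul (Complex.continuous_ofReal.comp hDc))
  have hM00 : 0 ≤ M0 := (norm_nonneg _).trans (hM0 x₀)
  have hM10 : 0 ≤ M1 := (norm_nonneg _).trans (hM1 x₀)
  have hM20 : 0 ≤ M2 := (norm_nonneg _).trans (hM2 x₀)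
  set K := tsupport ψ with hK
  have hKfin : μ K ≠ ∞ := hψc.isCompact.measure_lt_top.ne
  have hKm : MeasurableSet K := (isClosed_tsupport ψ).measurableSet
  refine ⟨M0 * C₀ + (M0 + M1 + M2) * (μ K).toReal, ?_⟩
  intro τ lam L hτ hτ1 hlam hlt
  set κ : ℝ := L v / lam with hκ
  set P : W → ℝ := fun p => κ + D p with hP
  have hPs : ContDiff ℝ (⊤ : ℕ∞) P := contDiff_const.add hDs
  set e2 : ℝ := τ ^ (2 * k + 3) with he2
  have he20 : 0 < e2 := by positivity
  have he21 : e2 ≤ 1 := pow_le_one₀ hτ.le hτ1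
  have hden : ∀ p, 0 < e2 + P p ^ 2 := fun p => by positivity
  set w : W → ℝ := fun p => P p / (e2 + P p ^ 2) with hw
  have hws : ContDiff ℝ (⊤ : ℕ∞) w :=
    hPs.div (contDiff_const.add (hPs.pow 2)) (fun p => (hden p).ne')
  set ex : W → ℂ := fun p => Complex.exp (Complex.I * ((L p + lam * φ p : ℝ) : ℂ)) with hex
  have hΦs : ContDiff ℝ (⊤ : ℕ∞) (fun p => L p + lam * φ p) :=
    L.contDiff.add (contDiff_const.mul hφ)
  have hexs : ContDiff ℝ (⊤ : ℕ∞) ex :=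
    (contDiff_const.mul (Complex.ofRealCLM.contDiff.comp hΦs)).cexp
  have hexn : ∀ p, ‖ex p‖ = 1 := fun p => by
    rw [hex]; simp only; rw [mul_comm]; exact Complex.norm_exp_ofReal_mul_I _
  set a : W → ℂ := fun p => ψ p * ((w p : ℝ) : ℂ) with ha
  have has : ContDiff ℝ (⊤ : ℕ∞) a := hψ.mul (Complex.ofRealCLM.contDiff.comp hws)
  have hac : HasCompactSupport a := hψc.mul_right
  -- derivatives
  have hexd : ∀ p, fderiv ℝ ex p v = ex p * (Complex.I * ((lam * P p : ℝ) : ℂ)) := by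
    intro p
    have h1 : HasFDerivAt (fun p => L p + lam * φ p) (L + lam • fderiv ℝ φ p) p :=
      L.hasFDerivAt.add (((hφ.differentiable (by simp) p).hasFDerivAt).const_mul lam)
    have h2 := ((Complex.ofRealCLM.hasFDerivAt.comp p h1).const_mul Complex.I).cexp
    have h3 : HasFDerivAt ex _ p := h2
    rw [h3.fderiv]
    have : lam * P p = L v + lam * fderiv ℝ φ p v := by
      simp only [hP, hκ, hD]; field_simp
    rw [this]
    simp [hex]
    ring
  have hwd : ∀ p, fderiv ℝ w p v = fderiv ℝ D p v * ((e2 - P p ^ 2) / (e2 + P p ^ 2) ^ 2) := by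
    intro p
    have h1 : HasFDerivAt P (fderiv ℝ D p) p :=
      ((hDs.differentiable (by simp) p).hasFDerivAt).const_add κ
    have hdd := (hden p).ne'
    have h2 := (hasDerivAt_id (P p)).div (((hasDerivAt_id (P p)).pow 2).const_add e2) hdd
    have h4 : HasFDerivAt w _ p := h2.comp_hasFDerivAt p h1
    rw [h4.fderiv]
    simp
    field_simp
    ring
  have had : ∀ p, fderiv ℝ a p v = fderiv ℝ ψ p v * ((w p : ℝ) : ℂ) +
      ψ p * ((fderiv ℝ w p v : ℝ) : ℂ) := by
    intro p
    have h1 := (hψ.differentiable (by simp) p).hasFDerivAt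
    have h2 := Complex.ofRealCLM.hasFDerivAt.comp p (hws.differentiable (by simp) p).hasFDerivAt
    have h3 : HasFDerivAt a _ p := h1.mul h2
    rw [h3.fderiv]
    simp [mul_comm]
    ring
  have ha'c : Continuous (fun p => fderiv ℝ a p v) :=
    ((has.fderiv_right (m := (⊤ : ℕ∞)) (by simp)).continuous).clm_apply continuous_const
  have hex'c : Continuous (fun p => fderiv ℝ ex p v) :=
    ((hexs.fderiv_right (m := (⊤ : ℕ∞)) (by simp)).continuous).clm_apply continuous_const
  have ha'cs : HasCompactSupport (fun p => fderiv ℝ a p v) := hac.fderiv_apply (𝕜 := ℝ) v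
  have i1 : Integrable (fun p => fderiv ℝ ex p v * a p) μ :=
    (hex'c.mul has.continuous).integrable_of_hasCompactSupport hac.mul_left
  have i2 : Integrable (fun p => ex p * fderiv ℝ a p v) μ :=
    (hexs.continuous.mul ha'c).integrable_of_hasCompactSupport ha'cs.mul_left
  have i3 : Integrable (fun p => ex p * a p) μ :=
    (hexs.continuous.mul has.continuous).integrable_of_hasCompactSupport hac.mul_left
  have ibp := integral_mul_fderiv_eq_neg_fderiv_mul_of_integrable (𝕜 := ℂ) i1 i2 i3
    (fun p _ => hexs.differentiable (by simp) p) (fun p _ => has.differentiable (by simp) p)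
  -- the remainder
  have hI0 : (Complex.I * (lam : ℂ)) ≠ 0 :=
    mul_ne_zero Complex.I_ne_zero (by exact_mod_cast hlam)
  set R : W → ℂ := fun p => ex p * ψ p * ((e2 / (e2 + P p ^ 2) : ℝ) : ℂ)
    - (Complex.I * (lam : ℂ))⁻¹ * (ex p * fderiv ℝ a p v) with hR
  have split : ∀ p, ex p * ψ p = R p + (Complex.I * (lam : ℂ))⁻¹ *
      (ex p * fderiv ℝ a p v + fderiv ℝ ex p v * a p) := by
    intro p
    have h1 : ((e2 / (e2 + P p ^ 2) : ℝ) : ℂ) + ((P p * w p : ℝ) : ℂ) = 1 := by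
      rw [← Complex.ofReal_add]
      have := (hden p).ne'
      have : e2 / (e2 + P p ^ 2) + P p * w p = 1 := by
        simp only [hw]; field_simp
      rw [this]; simp
    have h2 : (Complex.I * (lam : ℂ))⁻¹ * (fderiv ℝ ex p v * a p) =
        ex p * ψ p * ((P p * w p : ℝ) : ℂ) := by
      rw [hexd, ha]
      push_cast
      have hl : (lam : ℂ) ≠ 0 := by exact_mod_cast hlam
      have hi := Complex.I_ne_zero
      field_simp
    rw [mul_add, h2, hR]
    linear_combination (- ex p * ψ p) * h1
  have hRi : Integrable R μ := by
    apply Integrable.sub _ (i2.const_mul _)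
    apply Continuous.integrable_of_hasCompactSupport
    · exact (hexs.continuous.mul hψ.continuous).mul (Complex.continuous_ofReal.comp
        (continuous_const.div (continuous_const.add (hPs.continuous.pow 2)) (fun p => (hden p).ne')))
    · exact HasCompactSupport.mul_right hψc.mul_left
  have hint : ∫ p, ex p * ψ p ∂μ = ∫ p, R p ∂μ := by
    simp_rw [split]
    have i4 : Integrable (fun p => (Complex.I * (lam : ℂ))⁻¹ *
      (ex p * fderiv ℝ a p v + fderiv ℝ ex p v * a p)) μ := (i2.add i1).const_mul _
    rw [integral_add hRi i4, integral_const_mul, integral_add i2 i1, ibp]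
    simp
  set S := Metric.ball x₀ r ∩ {q | |κ + fderiv ℝ φ q v| ≤ τ ^ (k+1)} with hS
  have hSm : MeasurableSet S :=
    measurableSet_ball.inter (measurableSet_le
      (by have := hPs.continuous; exact (this.abs).measurable) measurable_const)
  have hSb : μ S ≤ ENNReal.ofReal (C₀ * τ) := by
    have := hsub κ (τ ^ (k+1)) (by positivity)
    rwa [Real.pow_rpow_inv_natCast hτ.le (by omega)] at this
  have hSfin : μ S ≠ ∞ := (hSb.trans_lt ENNReal.ofReal_lt_top).ne
  have hSr : (μ S).toReal ≤ C₀ * τ := ENNReal.toReal_le_of_le_ofReal (by positivity) hSb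
  have ee : |lam|⁻¹ * e2⁻¹ = τ := by
    rw [hlt, he2]; field_simp; ring
  have bound : ∀ p, ‖R p‖ ≤ S.indicator (fun _ => M0) p +
      K.indicator (fun _ => (M0 + M1 + M2) * τ) p := by
    intro p
    by_cases hp : p ∈ K
    · rw [Set.indicator_of_mem hp]
      have b1 : ‖fderiv ℝ a p v‖ ≤ (M1 + M2) * e2⁻¹ := by
        rw [had, hwd]
        have hd := hden p
        have w1 : |w p| ≤ e2⁻¹ := by
          simp only [hw]
          rw [abs_div, abs_of_pos hd, div_le_iff₀ hd, ← div_eq_inv_mul, le_div_iff₀ he20]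
          rw [← sq_abs (P p)]
          rcases le_total (|P p|) 1 with h1 | h1
          · nlinarith [abs_nonneg (P p)]
          · nlinarith [abs_nonneg (P p)]
        have w2 : |(e2 - P p ^ 2) / (e2 + P p ^ 2) ^ 2| ≤ e2⁻¹ := by
          rw [abs_div, abs_of_pos (pow_pos hd 2), div_le_iff₀ (pow_pos hd 2), ← div_eq_inv_mul,
            le_div_iff₀ he20]
          have : |e2 - P p ^ 2| ≤ e2 + P p ^ 2 := by
            rw [abs_le]; constructor <;> nlinarith [sq_nonneg (P p)]
          nlinarith [sq_nonneg (P p)]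
        calc _ ≤ ‖fderiv ℝ ψ p v‖ * |w p| + ‖ψ p * ((fderiv ℝ D p v : ℝ) : ℂ)‖ *
              |(e2 - P p ^ 2) / (e2 + P p ^ 2) ^ 2| := by
              refine (norm_add_le _ _).trans (le_of_eq ?_)
              rw [norm_mul, Complex.norm_real, Real.norm_eq_abs, Complex.ofReal_mul, ← mul_assoc,
                norm_mul (ψ p * _), Complex.norm_real, Real.norm_eq_abs]
          _ ≤ M1 * e2⁻¹ + M2 * e2⁻¹ := by
              gcongr
              · exact hM1 p
              · exact hM2 p
          _ = _ := by ring
      have b2 : ‖(Complex.I * (lam : ℂ))⁻¹ * (ex p * fderiv ℝ a p v)‖ ≤ (M1 + M2) * τ := by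
        rw [norm_mul, norm_mul, hexn, one_mul, norm_inv, norm_mul, Complex.norm_I, one_mul,
          Complex.norm_real, Real.norm_eq_abs]
        calc _ ≤ |lam|⁻¹ * ((M1 + M2) * e2⁻¹) := by gcongr
          _ = (M1 + M2) * (|lam|⁻¹ * e2⁻¹) := by ring
          _ = _ := by rw [ee]
      have b3 : ‖ex p * ψ p * ((e2 / (e2 + P p ^ 2) : ℝ) : ℂ)‖ ≤
          S.indicator (fun _ => M0) p + M0 * τ := by
        rw [norm_mul, norm_mul, hexn, one_mul, Complex.norm_real, Real.norm_eq_abs,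
          abs_of_pos (div_pos he20 (hden p))]
        by_cases hpS : p ∈ S
        · rw [Set.indicator_of_mem hpS]
          have : e2 / (e2 + P p ^ 2) ≤ 1 := by
            rw [div_le_one (hden p)]; nlinarith [sq_nonneg (P p)]
          have : ‖ψ p‖ * (e2 / (e2 + P p ^ 2)) ≤ M0 * 1 := by
            have := hden p
            gcongr
            exact hM0 p
          have : 0 ≤ M0 * τ := by positivity
          linarith
        · rw [Set.indicator_of_notMem hpS, zero_add]
          have hlt : τ ^ (k+1) < |P p| := by
            by_contra! hcon
            exact hpS ⟨hψs hp, hcon⟩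
          have hsq : (τ ^ (k+1)) ^ 2 ≤ P p ^ 2 := by
            rw [← sq_abs (P p)]; gcongr
          have : e2 / (e2 + P p ^ 2) ≤ τ := by
            rw [div_le_iff₀ (hden p)]
            have e3 : e2 = τ * (τ ^ (k+1)) ^ 2 := by rw [he2]; ring
            have : 0 < τ * e2 := by positivity
            nlinarith
          have hd := hden p
          gcongr
          exact hM0 p
      calc ‖R p‖ ≤ _ := norm_sub_le _ _
        _ ≤ _ := add_le_add b3 b2
        _ = _ := by ring
    · have z1 : ψ p = 0 := image_eq_zero_of_notMem_tsupport hp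
      have z2 : fderiv ℝ a p v = 0 := by
        have : fderiv ℝ a p = 0 := by
          apply image_eq_zero_of_notMem_tsupport
          intro hh
          exact hp (closure_mono (Function.support_mul_subset_left _ _)
            (tsupport_fderiv_subset ℝ hh))
        rw [this]; rfl
      rw [Set.indicator_of_notMem hp]
      simp only [hR, z1, z2]
      simp only [mul_zero, zero_mul, sub_zero, norm_zero, add_zero]
      exact Set.indicator_nonneg (fun _ _ => hM00) _
  rw [hint]
  have j1 : Integrable (S.indicator (fun _ => M0)) μ :=
    (integrable_indicator_iff hSm).2 (integrableOn_const hSfin)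
  have j2 : Integrable (K.indicator (fun _ => (M0 + M1 + M2) * τ)) μ :=
    (integrable_indicator_iff hKm).2 (integrableOn_const hKfin)
  calc ‖∫ p, R p ∂μ‖ ≤ ∫ p, (S.indicator (fun _ => M0) p +
      K.indicator (fun _ => (M0 + M1 + M2) * τ) p) ∂μ :=
        norm_integral_le_of_norm_le (j1.add j2) (Eventually.of_forall bound)
    _ = (μ S).toReal * M0 + (μ K).toReal * ((M0 + M1 + M2) * τ) := by
        rw [integral_add j1 j2, integral_indicator hSm, integral_indicator hKm]
        simp [Measure.real]
    _ ≤ (C₀ * τ) * M0 + (μ K).toReal * ((M0 + M1 + M2) * τ) := by gcongr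
    _ = _ := by ring
end multi

section glob
variable {W : Type*} [NormedAddCommGroup W] [NormedSpace ℝ W] [FiniteDimensional ℝ W]
  [MeasurableSpace W] [BorelSpace W]

open scoped Manifold ContDiff in
lemma osc_global (μ : Measure W) [μ.IsAddHaarMeasure] {φ : W → ℝ}
    (hφ : ContDiff ℝ (⊤ : ℕ∞) φ) (k : ℕ) {m : W → ℂ} (hm : ContDiff ℝ (⊤ : ℕ∞) m)
    (hmc : HasCompactSupport m) (w : Fin (k+2) → W)
    (h : ∀ q ∈ tsupport m, iteratedFDeriv ℝ (k+2) φ q w ≠ 0) :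
    ∃ C : ℝ, ∀ (τ lam : ℝ) (L : W →L[ℝ] ℝ), 0 < τ → τ ≤ 1 → lam ≠ 0 → |lam|⁻¹ = τ ^ (2 * k + 4) →
      ‖∫ p, Complex.exp (Complex.I * ((L p + lam * φ p : ℝ) : ℂ)) * m p ∂μ‖ ≤ C * τ := by
  have hloc : ∀ q : W, ∃ (v : W) (r c s : ℝ), q ∈ tsupport m → (0 < r ∧ 0 < c ∧ |s| = 1 ∧
      ∀ p ∈ Metric.ball q r, c ≤ s * iteratedFDeriv ℝ (k+2) φ p (fun _ => v)) := by
    intro q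
    by_cases hq : q ∈ tsupport m
    swap
    · exact ⟨0, 0, 0, 0, fun hh => absurd hh hq⟩
    obtain ⟨v, hv⟩ := exists_diag hφ (k+1) q w (h q hq)
    have hcont : Continuous (fun p => iteratedFDeriv ℝ (k+2) φ p (fun _ => v)) := by
      have := hφ.continuous_iteratedFDeriv (m := k+2) (WithTop.coe_le_coe.2 (le_top : ((k+2 : ℕ) : ℕ∞) ≤ ⊤))
      exact (ContinuousMultilinearMap.apply ℝ (fun _ : Fin (k+2) => W) ℝ (fun _ => v)).continuous.comp this
    obtain ⟨s, hs, hpos⟩ : ∃ s : ℝ, |s| = 1 ∧ 0 < s * iteratedFDeriv ℝ (k+2) φ q (fun _ => v) := by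
      rcases lt_or_gt_of_ne hv with h1 | h1
      · exact ⟨-1, by simp, by linarith⟩
      · exact ⟨1, by simp, by linarith⟩
    set c := s * iteratedFDeriv ℝ (k+2) φ q (fun _ => v) / 2 with hc
    have hev : ∀ᶠ p in nhds q, c < s * iteratedFDeriv ℝ (k+2) φ p (fun _ => v) :=
      ((show Continuous (fun p => s * iteratedFDeriv ℝ (k+2) φ p (fun _ => v)) from
        continuous_const.mul hcont).continuousAt (x := q)).eventually
        (lt_mem_nhds (by rw [hc]; linarith))
    obtain ⟨r, hr, hb⟩ := Metric.eventually_nhds_iff_ball.1 hev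
    exact ⟨v, r, c, s, fun _ => ⟨hr, by rw [hc]; linarith, hs, fun p hp => (hb p hp).le⟩⟩
  choose v r c s hall using hloc
  obtain ⟨t, ht, hcov⟩ := hmc.isCompact.elim_nhds_subcover (fun q => Metric.ball q (r q))
    (fun q hq => Metric.ball_mem_nhds q (hall q hq).1)
  obtain ⟨ρ, hρ⟩ := SmoothPartitionOfUnity.exists_isSubordinate 𝓘(ℝ, W) (isClosed_tsupport m)
    (fun q : t => Metric.ball (q : W) (r q)) (fun _ => Metric.isOpen_ball)
    (by
      intro p hp
      obtain ⟨q, hq, hpq⟩ := Set.mem_iUnion₂.1 (hcov hp)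
      exact Set.mem_iUnion.2 ⟨⟨q, hq⟩, hpq⟩)
  have hρs : ∀ q : t, ContDiff ℝ (⊤ : ℕ∞) (ρ q) := fun q => (ρ q).contMDiff.contDiff
  have hψs : ∀ q : t, ContDiff ℝ (⊤ : ℕ∞) (fun p => m p * ((ρ q p : ℝ) : ℂ)) := fun q =>
    hm.mul (Complex.ofRealCLM.contDiff.comp (hρs q))
  have hψc : ∀ q : t, HasCompactSupport (fun p => m p * ((ρ q p : ℝ) : ℂ)) := fun q => hmc.mul_right
  have hex : ∀ q : t, ∃ C : ℝ, ∀ (τ lam : ℝ) (L : W →L[ℝ] ℝ), 0 < τ → τ ≤ 1 → lam ≠ 0 →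
      |lam|⁻¹ = τ ^ (2 * k + 4) →
      ‖∫ p, Complex.exp (Complex.I * ((L p + lam * φ p : ℝ) : ℂ)) *
        (m p * ((ρ q p : ℝ) : ℂ)) ∂μ‖ ≤ C * τ := by
    intro q
    obtain ⟨h1, h2, h3, h4⟩ := hall q (ht q q.2)
    refine osc μ hφ k (v q) q (r q) (c q) (s q) h2 h3 h4 (hψs q) (hψc q) ?_
    refine subset_trans ?_ (hρ q)
    apply closure_mono
    intro p hp
    simp only [Function.mem_support] at hp ⊢
    intro h0
    exact hp (by rw [h0]; simp)
  choose C hC using hex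
  refine ⟨∑ q, C q, ?_⟩
  intro τ lam L h1 h2 h3 h4
  have hsum : ∀ p, Complex.exp (Complex.I * ((L p + lam * φ p : ℝ) : ℂ)) * m p =
      ∑ q, Complex.exp (Complex.I * ((L p + lam * φ p : ℝ) : ℂ)) * (m p * ((ρ q p : ℝ) : ℂ)) := by
    intro p
    rw [← Finset.mul_sum, ← Finset.mul_sum]
    by_cases hp : p ∈ tsupport m
    · have := ρ.sum_eq_one hp
      rw [finsum_eq_sum_of_fintype] at this
      rw [← Complex.ofReal_sum, this]; simp
    · rw [image_eq_zero_of_notMem_tsupport hp]; simp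
  simp_rw [hsum]
  rw [integral_finsetSum]
  · rw [Finset.sum_mul]
    exact (norm_sum_le _ _).trans (Finset.sum_le_sum fun q _ => hC q τ lam L h1 h2 h3 h4)
  · intro q _
    apply Continuous.integrable_of_hasCompactSupport
    · have := (hψs q).continuous
      have := hφ.continuous
      fun_prop
    · exact (hψc q).mul_left
end glob

lemma kernel_bound {d : ℕ} (φ : E d × E d → ℝ) (m : E d × E d → ℂ)
    (hφs : ContDiff ℝ (⊤ : ℕ∞) φ)
    (hms : ContDiff ℝ (⊤ : ℕ∞) m) (hmc : HasCompactSupport m)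
    (n : ℕ) (hn : 2 ≤ n) (w : Fin n → E d × E d)
    (h : ∀ p ∈ tsupport m, iteratedFDeriv ℝ n φ p w ≠ 0) :
    ∃ C : ℝ, ∀ lam : ℝ, lam ≠ 0 → ∀ L : (E d × E d) →L[ℝ] ℝ,
      ‖∫ p, Complex.exp (Complex.I * ((L p + lam * φ p : ℝ) : ℂ)) * m p‖ ≤
        C * |lam| ^ (-(1 : ℝ) / (2 * n)) := by
  obtain ⟨k, rfl⟩ : ∃ k, n = k + 2 := ⟨n - 2, by omega⟩
  haveI : (volume : Measure (E d × E d)).IsAddHaarMeasure := by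
    rw [Measure.volume_eq_prod]; infer_instance
  obtain ⟨C, hC⟩ := osc_global (volume : Measure (E d × E d)) hφs k hms hmc w h
  refine ⟨max C (∫ p, ‖m p‖), ?_⟩
  intro lam hlam L
  have hl : 0 < |lam| := abs_pos.2 hlam
  set τ := |lam| ^ (-(1 : ℝ) / (2 * ((k + 2 : ℕ) : ℝ))) with hτ
  have hτ0 : 0 < τ := by positivity
  have hpow : |lam|⁻¹ = τ ^ (2 * k + 4) := by
    rw [hτ, ← Real.rpow_natCast, ← Real.rpow_mul hl.le, ← Real.rpow_neg_one]
    congr 1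
    push_cast
    field_simp
    ring
  rcases le_total 1 |lam| with h1 | h1
  · have hτ1 : τ ≤ 1 := Real.rpow_le_one_of_one_le_of_nonpos h1
      (div_nonpos_of_nonpos_of_nonneg (by norm_num) (by positivity))
    exact (hC τ lam L hτ0 hτ1 hlam hpow).trans (by gcongr; exact le_max_left _ _)
  · have hτ1 : 1 ≤ τ := Real.one_le_rpow_of_pos_of_le_one_of_nonpos hl h1
      (div_nonpos_of_nonpos_of_nonneg (by norm_num) (by positivity))
    have h0 : 0 ≤ ∫ p, ‖m p‖ := integral_nonneg fun _ => norm_nonneg _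
    calc _ ≤ ∫ p, ‖Complex.exp (Complex.I * ((L p + lam * φ p : ℝ) : ℂ)) * m p‖ :=
          norm_integral_le_integral_norm _
      _ = ∫ p, ‖m p‖ := by
          congr 1; funext p
          rw [norm_mul, mul_comm Complex.I, Complex.norm_exp_ofReal_mul_I, one_mul]
      _ ≤ max C (∫ p, ‖m p‖) * 1 := by rw [mul_one]; exact le_max_right _ _
      _ ≤ _ := by gcongr

/-- The linear phase `p ↦ (x - z₁)·p₁ + (x - z₂)·p₂`. -/
def Lxz {d : ℕ} (x : E d) (z : E d × E d) : (E d × E d) →L[ℝ] ℝ :=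
  (innerSL ℝ (x - z.1)).comp (ContinuousLinearMap.fst ℝ (E d) (E d)) +
    (innerSL ℝ (x - z.2)).comp (ContinuousLinearMap.snd ℝ (E d) (E d))

lemma Lxz_apply {d : ℕ} (x : E d) (z p : E d × E d) :
    Lxz x z p = ⟪x - z.1, p.1⟫ + ⟪x - z.2, p.2⟫ := by
  simp [Lxz, inner_sub_left]

lemma Bop_eq {d : ℕ} (φ : E d × E d → ℝ) (m : E d × E d → ℂ)
    (hφ : Continuous φ) (hm : Continuous m) (hmc : HasCompactSupport m)
    (lam : ℝ) (f g : 𝓢(E d, ℂ)) (x : E d) :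
    Bop m φ lam f g x = (((2 * Real.pi) ^ (-(d : ℝ) / 2) : ℝ) : ℂ) ^ 3 *
      ∫ z : E d × E d, (f z.1 * g z.2) * ∫ p : E d × E d,
        Complex.exp (Complex.I * ((Lxz x z p + lam * φ p : ℝ) : ℂ)) *
          m p := by
  set c : ℂ := (((2 * Real.pi) ^ (-(d : ℝ) / 2) : ℝ) : ℂ) with hc
  set G : (E d × E d) → (E d × E d) → ℂ := fun p z => (f z.1 * g z.2) *
    (Complex.exp (Complex.I * ((Lxz x z p + lam * φ p : ℝ) : ℂ)) *
          m p) with hG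
  have hfg : Integrable (fun z : E d × E d => f z.1 * g z.2) := f.integrable.mul_prod g.integrable
  have hmi : Integrable m := hm.integrable_of_hasCompactSupport hmc
  have hGi : Integrable (Function.uncurry G) (volume.prod volume) := by
    have h1 := hmi.mul_prod hfg
    refine h1.mono ?_ ?_
    · apply Continuous.aestronglyMeasurable
      have hf := f.continuous
      have hg := g.continuous
      simp only [hG, Function.uncurry_def, Lxz_apply]
      fun_prop
    · refine Eventually.of_forall fun q => le_of_eq ?_
      simp only [hG, Function.uncurry_def]
      rw [norm_mul, norm_mul (Complex.exp _), mul_comm Complex.I, Complex.norm_exp_ofReal_mul_I,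
        one_mul, mul_comm, norm_mul (m _)]
  have hswap := integral_integral_swap hGi
  have hin : ∀ p : E d × E d, Complex.exp (Complex.I * ((⟪x, p.1 + p.2⟫ + lam * φ p : ℝ) : ℂ)) *
        m p * FT (⇑f) p.1 * FT (⇑g) p.2 = c ^ 2 * ∫ z, G p z := by
    intro p
    have e : (FT (⇑f) p.1) * FT (⇑g) p.2 = c ^ 2 * ∫ z : E d × E d,
        (Complex.exp (-(Complex.I * ((⟪z.1, p.1⟫ : ℝ) : ℂ))) * f z.1) *
        (Complex.exp (-(Complex.I * ((⟪z.2, p.2⟫ : ℝ) : ℂ))) * g z.2) := by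
      rw [Measure.volume_eq_prod, integral_prod_mul
        (fun y => Complex.exp (-(Complex.I * ((⟪y, p.1⟫ : ℝ) : ℂ))) * f y)
        (fun y => Complex.exp (-(Complex.I * ((⟪y, p.2⟫ : ℝ) : ℂ))) * g y)]
      simp only [FT, ← hc]
      ring
    rw [mul_assoc, e, mul_left_comm, ← integral_const_mul]
    congr 2
    funext z
    simp only [hG]
    have ee : Complex.exp (Complex.I * ((Lxz x z p + lam * φ p : ℝ) : ℂ)) =
        Complex.exp (Complex.I * ((⟪x, p.1 + p.2⟫ + lam * φ p : ℝ) : ℂ)) *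
        Complex.exp (-(Complex.I * ((⟪z.1, p.1⟫ : ℝ) : ℂ))) *
        Complex.exp (-(Complex.I * ((⟪z.2, p.2⟫ : ℝ) : ℂ))) := by
      rw [← Complex.exp_add, ← Complex.exp_add]
      congr 1
      simp only [Lxz_apply, inner_sub_left, inner_add_right]
      push_cast
      ring
    rw [ee]
    ring
  rw [Bop, ← hc]
  simp_rw [hin]
  rw [integral_const_mul, ← mul_assoc]
  congr 1
  · ring
  · refine hswap.trans ?_
    congr 1
    funext z
    exact integral_const_mul _ _

/-- If `φ, m ∈ C_0^∞(ℝ^{2d})` and for some multi-index `α` with `|α| = n ≥ 2`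
one has `|∂^α φ| ≥ c > 0` on `supp m`, then
`‖B_λ(f,g)‖_{L^∞} ≤ C |λ|^{-1/(2|α|)} ‖f‖_{L^1} ‖g‖_{L^1}`. -/
theorem statement2 {d : ℕ} (φ : E d × E d → ℝ) (m : E d × E d → ℂ)
    (hφs : ContDiff ℝ (⊤ : ℕ∞) φ) (hφc : HasCompactSupport φ)
    (hms : ContDiff ℝ (⊤ : ℕ∞) m) (hmc : HasCompactSupport m)
    (n : ℕ) (hn : 2 ≤ n) (α : Fin n → (Fin d ⊕ Fin d)) (c : ℝ) (hc : 0 < c)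
    (hα : ∀ p ∈ tsupport m,
      c ≤ |iteratedFDeriv ℝ n φ p (fun i => Sum.elim etaV xiV (α i))|) :
    ∃ C : ℝ, ∀ lam : ℝ, lam ≠ 0 → ∀ f g : 𝓢(E d, ℂ),
      eLpNorm (Bop m φ lam f g) ⊤ volume ≤
        ENNReal.ofReal (C * |lam| ^ (-(1 : ℝ) / (2 * n))) *
          (eLpNorm (⇑f) 1 volume * eLpNorm (⇑g) 1 volume) := by
  obtain ⟨C, hC⟩ := kernel_bound φ m hφs hms hmc n hn (fun i => Sum.elim etaV xiV (α i))
    (fun p hp h0 => by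
      have := hα p hp
      rw [h0, abs_zero] at this
      linarith)
  set c₀ : ℝ := (2 * Real.pi) ^ (-(d : ℝ) / 2) with hc₀
  have hc0 : 0 ≤ c₀ := by positivity
  refine ⟨c₀ ^ 3 * C, ?_⟩
  intro lam hlam f g
  have hB := hC lam hlam
  set T := C * |lam| ^ (-(1 : ℝ) / (2 * n)) with hT
  have hT0 : 0 ≤ T := (norm_nonneg _).trans (hB 0)
  have hpt : ∀ x, ‖Bop m φ lam f g x‖ ≤ c₀ ^ 3 * T * ((∫ y, ‖f y‖) * ∫ y, ‖g y‖) := by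
    intro x
    rw [Bop_eq φ m hφs.continuous hms.continuous hmc, norm_mul, norm_pow, Complex.norm_real,
      Real.norm_of_nonneg hc0, mul_assoc]
    refine mul_le_mul_of_nonneg_left ?_ (by positivity)
    have hfg : Integrable (fun z : E d × E d => ‖f z.1‖ * ‖g z.2‖) :=
      f.integrable.norm.mul_prod g.integrable.norm
    have e : (∫ y, ‖f y‖) * ∫ y, ‖g y‖ = ∫ z : E d × E d, ‖f z.1‖ * ‖g z.2‖ := by
      rw [Measure.volume_eq_prod, integral_prod_mul (fun y => ‖f y‖) (fun y => ‖g y‖)]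
    rw [e, ← integral_const_mul]
    apply norm_integral_le_of_norm_le (hfg.const_mul T)
    refine Eventually.of_forall fun z => ?_
    rw [norm_mul, norm_mul, mul_comm]
    exact mul_le_mul_of_nonneg_right (hB _) (by positivity)
  have hn1 : ∀ u : 𝓢(E d, ℂ), eLpNorm (⇑u) 1 volume = ENNReal.ofReal (∫ y, ‖u y‖) := by
    intro u
    rw [eLpNorm_one_eq_lintegral_enorm, ofReal_integral_norm_eq_lintegral_enorm u.integrable]
  rw [eLpNorm_exponent_top, hn1, hn1, ← ENNReal.ofReal_mul (integral_nonneg fun _ => norm_nonneg _),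
    mul_assoc, ← hT, ← ENNReal.ofReal_mul (by positivity)]
  exact eLpNormEssSup_le_of_ae_bound (Eventually.of_forall hpt)
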